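/- arXiv:math/9908161 — 10 statements merged into one kernel-verified Lean document; each statement's English description precedes it below -/
import Mathlib

section
/- Let v₁, v₂, v₃, v₄ ∈ ℍ² be nonzero column vectors and ν₁, ν₂, ν₃, ν₄ nonzero row covectors with νᵢvᵢ = 0 for each i, and assume the quaternions ν₁v₂, ν₃v₂, ν₃v₄, ν₁v₄ are all nonzero. Put q := (ν₁v₂)(ν₃v₂)⁻¹(ν₃v₄)(ν₁v₄)⁻¹. Then: (a) for any nonzero quaternions λ₁,…,λ₄ and μ₁,…,μ₄, the quaternion q̃ built in the same way from the rescaled data vᵢλᵢ and μᵢνᵢ equals μ₁ q μ₁⁻¹; in particular Re q̃ = Re q and |Im q̃| = |Im q|; (b) for every invertible M ∈ M₂(ℍ), the quaternion built in the same way from Mvᵢ and νᵢM⁻¹ equals q. Hence the real part and the norm of the imaginary part of q depend only on the four quaternionic lines vᵢℍ and are invariant under the action of GL(2,ℍ). -/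
open Quaternion Matrix

noncomputable section

/-- The real quaternions. -/
abbrev H : Type := Quaternion ℝ

/-- Pairing of a row covector `ν` with a column vector `v` in `ℍ²`: `νv = ν¹v¹ + ν²v²`. -/
def pairQ (ν v : Fin 2 → H) : H := ν 0 * v 0 + ν 1 * v 1

theorem pairQ_eq_dotProduct (ν v : Fin 2 → H) : pairQ ν v = ν ⬝ᵥ v := by
  simp [pairQ, dotProduct, Fin.sum_univ_two]

theorem pairQ_mul_mul (m l : H) (ν v : Fin 2 → H) :
    pairQ (fun k => m * ν k) (fun k => v k * l) = m * pairQ ν v * l := by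
  simp only [pairQ, mul_add, add_mul, mul_assoc]

theorem pairQ_vecMul_mulVec {M N : Matrix (Fin 2) (Fin 2) H} (hNM : N * M = 1)
    (ν v : Fin 2 → H) : pairQ (Matrix.vecMul ν N) (Matrix.mulVec M v) = pairQ ν v := by
  rw [pairQ_eq_dotProduct, pairQ_eq_dotProduct, dotProduct_mulVec, vecMul_vecMul, hNM,
    vecMul_one]

theorem re_mul_comm (a b : H) : (a * b).re = (b * a).re := by
  simp only [Quaternion.re_mul]
  ring

theorem re_conj {m : H} (hm : m ≠ 0) (q : H) : (m * q * m⁻¹).re = q.re := by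
  rw [re_mul_comm, inv_mul_cancel_left₀ hm]

theorem im_conj {m : H} (hm : m ≠ 0) (q : H) : (m * q * m⁻¹).im = m * q.im * m⁻¹ := by
  have h (x : H) : x.im = x - (x.re : H) := eq_sub_of_add_eq' x.re_add_im
  rw [h, h q, re_conj hm, mul_sub, sub_mul, ← Quaternion.coe_commutes,
    mul_inv_cancel_right₀ hm]

theorem norm_im_conj {m : H} (hm : m ≠ 0) (q : H) : ‖(m * q * m⁻¹).im‖ = ‖q.im‖ := by
  rw [im_conj hm, norm_mul, norm_mul, norm_inv, mul_right_comm,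
    mul_inv_cancel₀ (norm_ne_zero_iff.mpr hm), one_mul]

/-- The cross ratio expression `q = (ν₁v₂)(ν₃v₂)⁻¹(ν₃v₄)(ν₁v₄)⁻¹` built from homogeneous
coordinates is conjugated by `μ₁` under rescaling of the homogeneous coordinates (hence its
real part and the norm of its imaginary part are unchanged), and it is invariant under the
action of `GL(2,ℍ)`. -/
theorem stmt0
    (v₁ v₂ v₃ v₄ : Fin 2 → H) (ν₁ ν₂ ν₃ ν₄ : Fin 2 → H)
    (hv₁ : v₁ ≠ 0) (hv₂ : v₂ ≠ 0) (hv₃ : v₃ ≠ 0) (hv₄ : v₄ ≠ 0)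
    (hν₁ : ν₁ ≠ 0) (hν₂ : ν₂ ≠ 0) (hν₃ : ν₃ ≠ 0) (hν₄ : ν₄ ≠ 0)
    (h₁ : pairQ ν₁ v₁ = 0) (h₂ : pairQ ν₂ v₂ = 0)
    (h₃ : pairQ ν₃ v₃ = 0) (h₄ : pairQ ν₄ v₄ = 0)
    (h12 : pairQ ν₁ v₂ ≠ 0) (h32 : pairQ ν₃ v₂ ≠ 0)
    (h34 : pairQ ν₃ v₄ ≠ 0) (h14 : pairQ ν₁ v₄ ≠ 0)
    (q : H)
    (hq : q = pairQ ν₁ v₂ * (pairQ ν₃ v₂)⁻¹ * pairQ ν₃ v₄ * (pairQ ν₁ v₄)⁻¹)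
    -- (a) rescaled data `vᵢλᵢ`, `μᵢνᵢ`
    (l₁ l₂ l₃ l₄ μ₁ μ₂ μ₃ μ₄ : H)
    (hl₁ : l₁ ≠ 0) (hl₂ : l₂ ≠ 0) (hl₃ : l₃ ≠ 0) (hl₄ : l₄ ≠ 0)
    (hμ₁ : μ₁ ≠ 0) (hμ₂ : μ₂ ≠ 0) (hμ₃ : μ₃ ≠ 0) (hμ₄ : μ₄ ≠ 0)
    (q' : H)
    (hq' : q' =
      pairQ (fun k => μ₁ * ν₁ k) (fun k => v₂ k * l₂) *
        (pairQ (fun k => μ₃ * ν₃ k) (fun k => v₂ k * l₂))⁻¹ *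
        pairQ (fun k => μ₃ * ν₃ k) (fun k => v₄ k * l₄) *
        (pairQ (fun k => μ₁ * ν₁ k) (fun k => v₄ k * l₄))⁻¹)
    -- (b) the data transformed by an invertible `M ∈ M₂(ℍ)`: `Mvᵢ` and `νᵢM⁻¹`
    (M N : Matrix (Fin 2) (Fin 2) H) (hMN : M * N = 1) (hNM : N * M = 1)
    (qM : H)
    (hqM : qM =
      pairQ (Matrix.vecMul ν₁ N) (Matrix.mulVec M v₂) *
        (pairQ (Matrix.vecMul ν₃ N) (Matrix.mulVec M v₂))⁻¹ *
        pairQ (Matrix.vecMul ν₃ N) (Matrix.mulVec M v₄) *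
        (pairQ (Matrix.vecMul ν₁ N) (Matrix.mulVec M v₄))⁻¹) :
    q' = μ₁ * q * μ₁⁻¹ ∧ q'.re = q.re ∧ ‖q'.im‖ = ‖q.im‖ ∧ qM = q := by
  have hconj : q' = μ₁ * q * μ₁⁻¹ := by
    rw [hq', hq]
    simp only [pairQ_mul_mul, _root_.mul_inv_rev, mul_assoc]
    rw [mul_inv_cancel_left₀ hl₂, inv_mul_cancel_left₀ hμ₃, mul_inv_cancel_left₀ hl₄]
  refine ⟨hconj, ?_, ?_, ?_⟩
  · rw [hconj, re_conj hμ₁]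
  · rw [hconj, norm_im_conj hμ₁]
  · simp only [hqM, hq, pairQ_vecMul_mulVec hNM]
end
end

section
/- Let 𝔣, u, v : ℤ² → ℍ and λ ∈ ℝ, and let U, V : ℤ² → M₂(ℍ) be the associated rank-one matrices. Put F⁰_{m,n} := [[1,0],[𝔣_{m,n},1]] ∈ M₂(ℍ). Then for all (m,n): (F⁰_{m,n})⁻¹(I + λU_{m,n})F⁰_{m+1,n} = [[1, λu_{m,n}],[(∂₁𝔣)_{m,n}, 1]] and (F⁰_{m,n})⁻¹(I + λV_{m,n})F⁰_{m,n+1} = [[1, λv_{m,n}],[(∂₂𝔣)_{m,n}, 1]]. Consequently, a map T : ℤ² → M₂(ℍ) satisfies T_{m+1,n} = T_{m,n}(I + λU_{m,n}) and T_{m,n+1} = T_{m,n}(I + λV_{m,n}) for all (m,n) if and only if F := T·F⁰ (pointwise product) satisfies F_{m+1,n} = F_{m,n}·[[1, λu_{m,n}],[(∂₁𝔣)_{m,n}, 1]] and F_{m,n+1} = F_{m,n}·[[1, λv_{m,n}],[(∂₂𝔣)_{m,n}, 1]]. -/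
open Quaternion Matrix

noncomputable section

/-- 2×2 quaternionic matrices. -/
abbrev M2 : Type := Matrix (Fin 2) (Fin 2) H

/-- The rank-one matrix `x·q·ψ`, sending a column `y` to `x·q·(ψy)`. -/
def rankOne (x : Fin 2 → H) (q : H) (ψ : Fin 2 → H) : M2 :=
  Matrix.of fun i j => x i * q * ψ j

/-- The column `f_{m,n} = (1, 𝔣_{m,n})ᵀ ∈ ℍ²` associated to `𝔣 : ℤ² → ℍ`. -/
def fvec (f : ℤ → ℤ → H) (m n : ℤ) : Fin 2 → H := ![1, f m n]

/-- The row covector `φ_{m,n} = (−𝔣_{m,n}, 1)` associated to `𝔣 : ℤ² → ℍ`. -/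
def phiv (f : ℤ → ℤ → H) (m n : ℤ) : Fin 2 → H := ![-(f m n), 1]

/-- The rank-one matrix `U_{m,n} = f_{m,n}·u_{m,n}·φ_{m+1,n}`. -/
def Umat (f u : ℤ → ℤ → H) (m n : ℤ) : M2 :=
  rankOne (fvec f m n) (u m n) (phiv f (m+1) n)

/-- The rank-one matrix `V_{m,n} = f_{m,n}·v_{m,n}·φ_{m,n+1}`. -/
def Vmat (f v : ℤ → ℤ → H) (m n : ℤ) : M2 :=
  rankOne (fvec f m n) (v m n) (phiv f m (n+1))

/-- The "Euclidean frame" `F⁰_{m,n} = [[1,0],[𝔣_{m,n},1]]`. -/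
def F0 (f : ℤ → ℤ → H) (m n : ℤ) : M2 := !![1, 0; f m n, 1]

/-- The inverse `(F⁰_{m,n})⁻¹ = [[1,0],[−𝔣_{m,n},1]]` of the Euclidean frame. -/
def G0 (f : ℤ → ℤ → H) (m n : ℤ) : M2 := !![1, 0; -(f m n), 1]

theorem G0_mul_F0 (f : ℤ → ℤ → H) (m n : ℤ) : G0 f m n * F0 f m n = 1 := by
  ext1 i j
  fin_cases i <;> fin_cases j <;> simp [G0, F0, Matrix.mul_apply]

theorem F0_mul_G0 (f : ℤ → ℤ → H) (m n : ℤ) : F0 f m n * G0 f m n = 1 := by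
  ext1 i j
  fin_cases i <;> fin_cases j <;> simp [G0, F0, Matrix.mul_apply]

theorem rankOne_fvec_phiv (f : ℤ → ℤ → H) (q : H) (m n k l : ℤ) :
    rankOne (fvec f m n) q (phiv f k l)
      = !![-(q * f k l), q; -(f m n * (q * f k l)), f m n * q] := by
  ext1 i j
  fin_cases i <;> fin_cases j <;> simp [rankOne, fvec, phiv, mul_assoc]

/-- Gauging `1 + λ·f_{m,n}·q·φ_{k,l}` by the Euclidean frames at `(m, n)` and `(k, l)`. -/
theorem G0_mul_one_add_smul_rankOne_mul_F0 (f : ℤ → ℤ → H) (q : H) (lam : ℝ) (m n k l : ℤ) :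
    G0 f m n * (1 + lam • rankOne (fvec f m n) q (phiv f k l)) * F0 f k l
      = !![1, (lam : H) * q; f k l - f m n, 1] := by
  rw [Quaternion.coe_mul_eq_smul, rankOne_fvec_phiv]
  ext1 i j
  fin_cases i <;> fin_cases j <;>
    simp [G0, F0, Matrix.mul_apply, Fin.sum_univ_two, mul_add, neg_add_eq_sub]

/-- Cancellation form of a change of gauge. -/
theorem eq_mul_iff_gauge {R : Type*} [Monoid R] {t t' a b p g p' g' : R}
    (hpg : p * g = 1) (hpg' : p' * g' = 1) (h : g * a * p' = b) :
    t' = t * a ↔ t' * p' = t * p * b := by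
  have key : t * p * b = t * a * p' := by
    rw [← h, mul_assoc t p, mul_assoc g a, ← mul_assoc p g, hpg, one_mul, mul_assoc]
  rw [key]
  refine ⟨fun e => by rw [e], fun e => ?_⟩
  have e' := congrArg (· * g') e
  simpa only [mul_assoc, hpg', mul_one] using e'

/-- Gauge equivalence of the systems `T_{m+1,n} = T_{m,n}(1+λU_{m,n})`, ... and the
"curved flat" system for `F = T·F⁰`:
`(F⁰_{m,n})⁻¹(I+λU_{m,n})F⁰_{m+1,n} = [[1,λu_{m,n}],[∂₁𝔣_{m,n},1]]` etc. -/
theorem stmt3 (f u v : ℤ → ℤ → H) (lam : ℝ) (T : ℤ → ℤ → M2) :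
    (∀ m n : ℤ, G0 f m n * F0 f m n = 1 ∧ F0 f m n * G0 f m n = 1) ∧
    (∀ m n : ℤ, G0 f m n * (1 + lam • Umat f u m n) * F0 f (m+1) n
        = !![1, (lam : H) * u m n; f (m+1) n - f m n, 1]) ∧
    (∀ m n : ℤ, G0 f m n * (1 + lam • Vmat f v m n) * F0 f m (n+1)
        = !![1, (lam : H) * v m n; f m (n+1) - f m n, 1]) ∧
    ((∀ m n : ℤ, T (m+1) n = T m n * (1 + lam • Umat f u m n) ∧
        T m (n+1) = T m n * (1 + lam • Vmat f v m n)) ↔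
      (∀ m n : ℤ, T (m+1) n * F0 f (m+1) n
          = (T m n * F0 f m n) * !![1, (lam : H) * u m n; f (m+1) n - f m n, 1] ∧
        T m (n+1) * F0 f m (n+1)
          = (T m n * F0 f m n) * !![1, (lam : H) * v m n; f m (n+1) - f m n, 1])) := by
  have hU (m n : ℤ) := G0_mul_one_add_smul_rankOne_mul_F0 f (u m n) lam m n (m + 1) n
  have hV (m n : ℤ) := G0_mul_one_add_smul_rankOne_mul_F0 f (v m n) lam m n m (n + 1)
  refine ⟨fun m n => ⟨G0_mul_F0 f m n, F0_mul_G0 f m n⟩, hU, hV, ?_⟩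
  exact forall₂_congr fun m n => and_congr
    (eq_mul_iff_gauge (F0_mul_G0 f m n) (F0_mul_G0 f (m + 1) n) (hU m n))
    (eq_mul_iff_gauge (F0_mul_G0 f m n) (F0_mul_G0 f m (n + 1)) (hV m n))
end
end

section
/- Let 𝔣, u, v : ℤ² → ℍ and let U, V : ℤ² → M₂(ℍ) be the associated rank-one matrices. Then for all (m,n): U_{m,n}·V_{m+1,n} = 0 and V_{m,n}·U_{m,n+1} = 0, and for any λ ∈ ℝ with λ ≠ 0 the compatibility condition (I + λU_{m,n})(I + λV_{m+1,n}) = (I + λV_{m,n})(I + λU_{m,n+1}) holds if and only if U_{m,n} + V_{m+1,n} = V_{m,n} + U_{m,n+1}. -/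
open Quaternion Matrix

noncomputable section

theorem rankOne_mul_rankOne_of_dotProduct_eq_zero {x y φ ψ : Fin 2 → H} (p q : H)
    (h : φ ⬝ᵥ y = 0) : rankOne x p φ * rankOne y q ψ = 0 := by
  ext1 i j
  calc (rankOne x p φ * rankOne y q ψ) i j = x i * p * (φ ⬝ᵥ y) * q * ψ j := by
        simp only [rankOne, Matrix.mul_apply, Matrix.of_apply, dotProduct, Fin.sum_univ_two]
        noncomm_ring
    _ = 0 := by simp [h]

theorem phiv_dotProduct_fvec (f : ℤ → ℤ → H) (m n : ℤ) : phiv f m n ⬝ᵥ fvec f m n = 0 := by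
  simp [phiv, fvec, dotProduct, Fin.sum_univ_two]

theorem Umat_mul_Vmat (f u v : ℤ → ℤ → H) (m n : ℤ) :
    Umat f u m n * Vmat f v (m+1) n = 0 :=
  rankOne_mul_rankOne_of_dotProduct_eq_zero _ _ (phiv_dotProduct_fvec f (m+1) n)

theorem Vmat_mul_Umat (f u v : ℤ → ℤ → H) (m n : ℤ) :
    Vmat f v m n * Umat f u m (n+1) = 0 :=
  rankOne_mul_rankOne_of_dotProduct_eq_zero _ _ (phiv_dotProduct_fvec f m (n+1))

theorem one_add_smul_mul_one_add_smul {R A : Type*} [CommSemiring R] [Semiring A] [Algebra R A]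
    {a b : A} (h : a * b = 0) (r : R) :
    (1 + r • a) * (1 + r • b) = 1 + r • (a + b) := by
  simp only [add_mul, mul_add, one_mul, mul_one, smul_mul_smul_comm, h, smul_zero, add_zero, smul_add]
  abel

/-- `U_{m,n}·V_{m+1,n} = 0`, `V_{m,n}·U_{m,n+1} = 0`, and for `λ ≠ 0` the compatibility
condition `(I+λU_{m,n})(I+λV_{m+1,n}) = (I+λV_{m,n})(I+λU_{m,n+1})` holds iff
`U_{m,n} + V_{m+1,n} = V_{m,n} + U_{m,n+1}`. -/
theorem stmt4 (f u v : ℤ → ℤ → H) :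
    (∀ m n : ℤ, Umat f u m n * Vmat f v (m+1) n = 0 ∧
      Vmat f v m n * Umat f u m (n+1) = 0) ∧
    (∀ lam : ℝ, lam ≠ 0 → ∀ m n : ℤ,
      ((1 + lam • Umat f u m n) * (1 + lam • Vmat f v (m+1) n)
          = (1 + lam • Vmat f v m n) * (1 + lam • Umat f u m (n+1)) ↔
        Umat f u m n + Vmat f v (m+1) n = Vmat f v m n + Umat f u m (n+1))) := by
  refine ⟨fun m n => ⟨Umat_mul_Vmat f u v m n, Vmat_mul_Umat f u v m n⟩, fun lam hlam m n => ?_⟩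
  rw [one_add_smul_mul_one_add_smul (Umat_mul_Vmat f u v m n),
    one_add_smul_mul_one_add_smul (Vmat_mul_Umat f u v m n), add_right_inj]
  exact (smul_right_injective M2 hlam).eq_iff
end
end

section
/- Let 𝔣, u, v : ℤ² → ℍ with 𝔣_{m+1,n} ≠ 𝔣_{m,n} and 𝔣_{m,n+1} ≠ 𝔣_{m,n} for all (m,n), and let U, V : ℤ² → M₂(ℍ) be the associated rank-one matrices. Then the condition U_{m,n} + V_{m+1,n} = V_{m,n} + U_{m,n+1} holds for all (m,n) if and only if there exists a map 𝔣* : ℤ² → ℍ with u = ∂₁𝔣* and v = ∂₂𝔣*, and moreover 𝔣 and 𝔣* satisfy the dual (Christoffel) relations: (∂₁𝔣*)_{m,n}(∂₂𝔣)_{m+1,n} = (∂₂𝔣*)_{m,n}(∂₁𝔣)_{m,n+1} and (∂₁𝔣)_{m,n}(∂₂𝔣*)_{m+1,n} = (∂₂𝔣)_{m,n}(∂₁𝔣*)_{m,n+1} for all (m,n). -/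
open Quaternion Matrix

noncomputable section

/-- Every sequence on `ℤ` with values in an additive commutative group is the forward difference
of some sequence vanishing at `0`. -/
theorem exists_int_primitive {G : Type*} [AddCommGroup G] (h : ℤ → G) :
    ∃ g : ℤ → G, g 0 = 0 ∧ ∀ k, g (k + 1) - g k = h k := by
  refine ⟨fun k => ∑ i ∈ Finset.range k.toNat, h i
    - ∑ i ∈ Finset.range (-k).toNat, h (-(i + 1 : ℤ)), by simp, fun k => ?_⟩
  obtain ⟨n, rfl | rfl⟩ : ∃ n : ℕ, k = n ∨ k = -(n + 1 : ℤ) :=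
    ⟨if 0 ≤ k then k.toNat else (-k - 1).toNat, by split_ifs <;> omega⟩
  · have h₁ : (n + 1 : ℤ).toNat = n + 1 := by omega
    have h₂ : (-(n + 1 : ℤ)).toNat = 0 := by omega
    have h₃ : (-(n : ℤ)).toNat = 0 := by omega
    simp only [h₁, h₂, h₃, Int.toNat_natCast, Finset.sum_range_succ, Finset.range_zero,
      Finset.sum_empty]
    abel
  · have h₁ : (-(n + 1 : ℤ) + 1).toNat = 0 := by omega
    have h₂ : (-(-(n + 1 : ℤ) + 1)).toNat = n := by omega
    have h₃ : (-(n + 1 : ℤ)).toNat = 0 := by omega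
    have h₄ : (-(-(n + 1 : ℤ))).toNat = n + 1 := by omega
    simp only [h₁, h₂, h₃, h₄, Finset.sum_range_succ, Finset.range_zero, Finset.sum_empty]
    abel

/-- Discrete Poincaré lemma on `ℤ²`: a closed discrete one-form is exact. -/
theorem exists_potential_of_closed {G : Type*} [AddCommGroup G] (u v : ℤ → ℤ → G)
    (huv : ∀ m n, u m n + v (m + 1) n = v m n + u m (n + 1)) :
    ∃ p : ℤ → ℤ → G, ∀ m n, u m n = p (m + 1) n - p m n ∧ v m n = p m (n + 1) - p m n := by
  obtain ⟨g, -, hg⟩ := exists_int_primitive fun m => u m 0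
  choose w hw₀ hw using fun m => exists_int_primitive (v m)
  have hv : ∀ m n, v m n = g m + w m (n + 1) - (g m + w m n) := fun m n => by
    rw [← hw m n]; abel
  have step : ∀ m n, (u m (n + 1) = g (m + 1) + w (m + 1) (n + 1) - (g m + w m (n + 1))) ↔
      u m n = g (m + 1) + w (m + 1) n - (g m + w m n) := fun m n => by
    have h := huv m n
    rw [hv, hv] at h
    constructor <;> intro e <;> rw [e] at h
    · rw [eq_sub_of_add_eq h]; abel
    · rw [eq_sub_of_add_eq' h.symm]; abel
  refine ⟨fun m n => g m + w m n, fun m n => ⟨?_, hv m n⟩⟩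
  induction n using Int.induction_on with
  | zero => simp [hw₀, hg]
  | succ n ih => exact (step m n).2 ih
  | pred n ih => exact (step m (-n - 1)).1 (by simpa using ih)

/-- Around a single quadrilateral, the compatibility condition is closedness of the one-form
together with the two Christoffel relations. -/
theorem Umat_add_Vmat_eq_iff (f u v : ℤ → ℤ → H) (m n : ℤ) :
    Umat f u m n + Vmat f v (m + 1) n = Vmat f v m n + Umat f u m (n + 1) ↔
      u m n + v (m + 1) n = v m n + u m (n + 1) ∧
      u m n * (f (m + 1) (n + 1) - f (m + 1) n) = v m n * (f (m + 1) (n + 1) - f m (n + 1)) ∧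
      (f (m + 1) n - f m n) * v (m + 1) n = (f m (n + 1) - f m n) * u m (n + 1) := by
  simp only [← Matrix.ext_iff, Fin.forall_fin_two, Umat, Vmat, rankOne, fvec, phiv,
    Matrix.add_apply, Matrix.of_apply, Matrix.cons_val_zero, Matrix.cons_val_one, one_mul, mul_one]
  generalize f m n = a, f (m + 1) n = b, f (m + 1) (n + 1) = c, f m (n + 1) = d,
    u m n = p, v (m + 1) n = q, v m n = r, u m (n + 1) = s
  constructor
  · rintro ⟨⟨h₀₀, h₀₁⟩, -, h₁₁⟩
    refine ⟨h₀₁, ?_, ?_⟩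
    · linear_combination (norm := noncomm_ring) h₀₀ + h₀₁ * c
    · linear_combination (norm := noncomm_ring) h₁₁ - a * h₀₁
  · rintro ⟨h, h₁, h₂⟩
    refine ⟨⟨?_, h⟩, ?_, ?_⟩
    · linear_combination (norm := noncomm_ring) h₁ - h * c
    · linear_combination (norm := noncomm_ring) a * h₁ - a * h * c - h₂ * c
    · linear_combination (norm := noncomm_ring) h₂ + a * h

/-- The compatibility condition `U_{m,n} + V_{m+1,n} = V_{m,n} + U_{m,n+1}` holds for all
`(m,n)` iff `u = ∂₁𝔣*` and `v = ∂₂𝔣*` for some `𝔣* : ℤ² → ℍ` which together with `𝔣`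
satisfies the dual (Christoffel) relations. -/
theorem stmt5 (f u v : ℤ → ℤ → H)
    (hreg₁ : ∀ m n : ℤ, f (m+1) n ≠ f m n)
    (hreg₂ : ∀ m n : ℤ, f m (n+1) ≠ f m n) :
    (∀ m n : ℤ, Umat f u m n + Vmat f v (m+1) n = Vmat f v m n + Umat f u m (n+1)) ↔
    ∃ fs : ℤ → ℤ → H,
      (∀ m n : ℤ, u m n = fs (m+1) n - fs m n ∧ v m n = fs m (n+1) - fs m n) ∧
      (∀ m n : ℤ,
        (fs (m+1) n - fs m n) * (f (m+1) (n+1) - f (m+1) n)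
            = (fs m (n+1) - fs m n) * (f (m+1) (n+1) - f m (n+1)) ∧
        (f (m+1) n - f m n) * (fs (m+1) (n+1) - fs (m+1) n)
            = (f m (n+1) - f m n) * (fs (m+1) (n+1) - fs m (n+1))) := by
  simp only [Umat_add_Vmat_eq_iff]
  constructor
  · intro h
    obtain ⟨p, hp⟩ := exists_potential_of_closed u v fun m n => (h m n).1
    refine ⟨p, hp, fun m n => ?_⟩
    rw [← (hp m n).1, ← (hp m n).2, ← (hp (m + 1) n).2, ← (hp m (n + 1)).1]
    exact (h m n).2
  · rintro ⟨p, hp, hd⟩ m n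
    rw [(hp m n).1, (hp m n).2, (hp (m + 1) n).2, (hp m (n + 1)).1]
    exact ⟨by abel, hd m n⟩
end
end

section
/- Let 𝔣, 𝔣* : ℤ² → ℍ satisfy the dual (Christoffel) relations, and set 𝔡_{m,n} := (∂₁𝔣)_{m,n} − (∂₂𝔣)_{m,n}. Then for all (m,n) the following four identities hold: 𝔡_{m,n}(∂₁𝔣*)_{m,n+1}(∂₁𝔣)_{m,n+1} = (∂₁𝔣)_{m,n}(∂₁𝔣*)_{m,n}𝔡_{m,n}; 𝔡_{m,n}(∂₂𝔣*)_{m+1,n}(∂₂𝔣)_{m+1,n} = (∂₂𝔣)_{m,n}(∂₂𝔣*)_{m,n}𝔡_{m,n}; 𝔡_{m,n}(∂₂𝔣*)_{m+1,n}(∂₁𝔣)_{m,n+1} = (∂₂𝔣)_{m,n}(∂₁𝔣*)_{m,n}𝔡_{m,n}; 𝔡_{m,n}(∂₁𝔣*)_{m,n+1}(∂₂𝔣)_{m+1,n} = (∂₁𝔣)_{m,n}(∂₂𝔣*)_{m,n}𝔡_{m,n}. -/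
open Quaternion

noncomputable section

/-- The identities on a single quadrilateral with edges `a`, `b`, `a'`, `b'` and dual edges
`p`, `q`, `p'`, `q'`. -/
theorem dual_quad_identities {R : Type*} [Ring R] (a b a' b' p q p' q' : R)
    (hf : a - b = a' - b') (hs : p - q = p' - q')
    (h₁ : p * b' = q * a') (h₂ : a * q' = b * p') :
    (a - b) * p' * a' = a * p * (a - b) ∧ (a - b) * q' * b' = b * q * (a - b) ∧
      (a - b) * q' * a' = b * p * (a - b) ∧ (a - b) * p' * b' = a * q * (a - b) := by
  have ha : (p - q) * a' = p * (a - b) := by rw [hf, sub_mul, mul_sub, h₁]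
  have hb : (p - q) * b' = q * (a - b) := by rw [hf, sub_mul, mul_sub, h₁]
  have hp : (a - b) * p' = a * (p - q) := by rw [hs, sub_mul, mul_sub, h₂]
  have hq : (a - b) * q' = b * (p - q) := by rw [hs, sub_mul, mul_sub, h₂]
  refine ⟨?_, ?_, ?_, ?_⟩
  · rw [hp, mul_assoc, ha, mul_assoc]
  · rw [hq, mul_assoc, hb, mul_assoc]
  · rw [hq, mul_assoc, ha, mul_assoc]
  · rw [hp, mul_assoc, hb, mul_assoc]

/-- Consequences of the dual (Christoffel) relations: with
`𝔡_{m,n} = (∂₁𝔣)_{m,n} − (∂₂𝔣)_{m,n}`, the four identities `(DualConsequences)` hold. -/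
theorem stmt6 (f fs : ℤ → ℤ → H)
    (hdual : ∀ m n : ℤ,
      (fs (m+1) n - fs m n) * (f (m+1) (n+1) - f (m+1) n)
          = (fs m (n+1) - fs m n) * (f (m+1) (n+1) - f m (n+1)) ∧
      (f (m+1) n - f m n) * (fs (m+1) (n+1) - fs (m+1) n)
          = (f m (n+1) - f m n) * (fs (m+1) (n+1) - fs m (n+1))) :
    ∀ m n : ℤ,
      ((f (m+1) n - f m n) - (f m (n+1) - f m n)) *
            (fs (m+1) (n+1) - fs m (n+1)) * (f (m+1) (n+1) - f m (n+1))
          = (f (m+1) n - f m n) * (fs (m+1) n - fs m n) *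
            ((f (m+1) n - f m n) - (f m (n+1) - f m n)) ∧
      ((f (m+1) n - f m n) - (f m (n+1) - f m n)) *
            (fs (m+1) (n+1) - fs (m+1) n) * (f (m+1) (n+1) - f (m+1) n)
          = (f m (n+1) - f m n) * (fs m (n+1) - fs m n) *
            ((f (m+1) n - f m n) - (f m (n+1) - f m n)) ∧
      ((f (m+1) n - f m n) - (f m (n+1) - f m n)) *
            (fs (m+1) (n+1) - fs (m+1) n) * (f (m+1) (n+1) - f m (n+1))
          = (f m (n+1) - f m n) * (fs (m+1) n - fs m n) *
            ((f (m+1) n - f m n) - (f m (n+1) - f m n)) ∧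
      ((f (m+1) n - f m n) - (f m (n+1) - f m n)) *
            (fs (m+1) (n+1) - fs m (n+1)) * (f (m+1) (n+1) - f (m+1) n)
          = (f (m+1) n - f m n) * (fs m (n+1) - fs m n) *
            ((f (m+1) n - f m n) - (f m (n+1) - f m n)) := by
  intro m n
  obtain ⟨h₁, h₂⟩ := hdual m n
  exact dual_quad_identities _ _ _ _ _ _ _ _ (by abel) (by abel) h₁ h₂
end
end

section
/- Let 𝔣, 𝔣* : ℤ² → ℍ be discrete nets satisfying the dual (Christoffel) relations, and suppose that a_{m,n} := (∂₁𝔣*)_{m,n}(∂₁𝔣)_{m,n} and b_{m,n} := (∂₂𝔣*)_{m,n}(∂₂𝔣)_{m,n} are real numbers for all (m,n). Then a_{m,n} is independent of n and b_{m,n} is independent of m; that is, there are functions a, b : ℤ → ℝ with a_{m,n} = a_m and b_{m,n} = b_n for all (m,n), so the cross ratios of the elementary quadrilaterals of 𝔣 factorize as q_{m,n} = a_m/b_n. -/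
open Quaternion

noncomputable section

/-- A discrete net: at every `(m,n)` the differences `(∂₁𝔣)_{m,n}` and `(∂₂𝔣)_{m,n}` are
nonzero and are not real scalar multiples of one another. -/
def IsNet (f : ℤ → ℤ → H) : Prop :=
  ∀ m n : ℤ, f (m+1) n - f m n ≠ 0 ∧ f m (n+1) - f m n ≠ 0 ∧
    (∀ r : ℝ, f (m+1) n - f m n ≠ r • (f m (n+1) - f m n)) ∧
    (∀ r : ℝ, f m (n+1) - f m n ≠ r • (f (m+1) n - f m n))

/-- The quaternionic cross ratio `cr(p₁,p₂,p₃,p₄) = (p₁−p₂)(p₂−p₃)⁻¹(p₃−p₄)(p₄−p₁)⁻¹`. -/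
def cr (p₁ p₂ p₃ p₄ : H) : H := (p₁ - p₂) * (p₂ - p₃)⁻¹ * (p₃ - p₄) * (p₄ - p₁)⁻¹

theorem mul_eq_coe_comm {p q : H} {r : ℝ} (hp : p ≠ 0) (h : q * p = (r : H)) :
    p * q = (r : H) := by
  apply mul_right_cancel₀ hp
  rw [mul_assoc, h, Quaternion.coe_commutes]

/-- Opposite edges of an elementary quadrilateral carry the same labels: `x, y, x', y'` are the
edges of `f` (with `x'` opposite to `x`), and `X, Y, X', Y'` those of its dual. -/
theorem quad_labels_eq {x y x' y' X Y X' Y' : H} {a b a' b' : ℝ}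
    (hx : X * x = (a : H)) (hy : Y * y = (b : H)) (hx' : X' * x' = (a' : H))
    (hy' : Y' * y' = (b' : H)) (h₁ : X * y' = Y * x') (h₂ : x * Y' = y * X')
    (hc : x + y' = y + x') (hC : X + Y' = Y + X')
    (x0 : x ≠ 0) (y0 : y ≠ 0) (x'0 : x' ≠ 0) (y'0 : y' ≠ 0) (Y0 : Y ≠ 0)
    (hxy : ∀ r : ℝ, x ≠ r • y) : a = a' ∧ b = b' := by
  have hxr : x * X = (a : H) := mul_eq_coe_comm x0 hx
  have hyr : y * Y = (b : H) := mul_eq_coe_comm y0 hy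
  have hxr' : x' * X' = (a' : H) := mul_eq_coe_comm x'0 hx'
  have b0 : b ≠ 0 := by
    rintro rfl
    exact mul_ne_zero Y0 y0 (by simpa using hy)
  have hW : ∀ r : ℝ, x * Y ≠ (r : H) := by
    intro r hr
    apply hxy (r / b)
    have h : b • x = r • y := by
      rw [← Quaternion.coe_mul_eq_smul r, ← hr, mul_assoc, hy, Quaternion.mul_coe_eq_smul]
    rw [div_eq_inv_mul, mul_smul, ← h, smul_smul, inv_mul_cancel₀ b0, one_smul]
  have hWV : a • (y' * Y) = x * Y * (x' * Y) := by
    calc a • (y' * Y) = x * (X * y') * Y := by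
          rw [← Quaternion.coe_mul_eq_smul, ← hxr]; noncomm_ring
      _ = _ := by rw [h₁]; noncomm_ring
  have hVW : b' • (x' * Y * (x * Y)) = (b * a') • (y' * Y) := by
    calc b' • (x' * Y * (x * Y)) = x' * Y * (x * (Y' * y')) * Y := by
          rw [hy', Quaternion.mul_coe_eq_smul]
          simp only [mul_smul_comm, smul_mul_assoc, mul_assoc]
      _ = x' * (Y * y) * X' * y' * Y := by rw [← mul_assoc x, h₂]; noncomm_ring
      _ = b • (x' * X' * y' * Y) := by
          rw [hy, Quaternion.mul_coe_eq_smul]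
          simp only [smul_mul_assoc]
      _ = _ := by
          rw [hxr', Quaternion.coe_mul_eq_smul, smul_mul_assoc, smul_smul]
  have hU : y' * Y = (b : H) + x' * Y - x * Y := by
    rw [← hyr, ← add_mul, ← sub_mul, ← hc, add_sub_cancel_left]
  have haa : a = a' := by
    by_contra hne
    have hV : a • (x' * Y) + (a' * b : ℝ) = x * Y * (x' * Y) + a' • (x * Y) := by
      calc a • (x' * Y) + ((a' * b : ℝ) : H) = x * X * (x' * Y) + y * (X' * x') * Y := by
            rw [hxr, Quaternion.coe_mul_eq_smul, hx', Quaternion.mul_coe_eq_smul,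
              smul_mul_assoc, hyr, Quaternion.coe_mul, Quaternion.coe_mul_eq_smul]
        _ = x * (X + Y') * (x' * Y) := by
            rw [mul_add, h₂]; noncomm_ring
        _ = x * Y * (x' * Y) + x * (X' * x') * Y := by rw [hC]; noncomm_ring
        _ = _ := by rw [hx', Quaternion.mul_coe_eq_smul, smul_mul_assoc]
    have h : (a' - a) • (x * Y) = (a' - a) • (b : H) := by
      rw [← hWV, hU, Quaternion.coe_mul, Quaternion.coe_mul_eq_smul] at hV
      rw [← sub_eq_zero] at hV ⊢
      rw [← neg_eq_zero, ← hV]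
      module
    exact hW b (smul_right_injective H (sub_ne_zero.mpr (Ne.symm hne)) h)
  refine ⟨haa, ?_⟩
  have hcomm : x * Y * (x' * Y) = x' * Y * (x * Y) := by
    have hWa : x * Y - (a : H) ≠ 0 := sub_ne_zero.mpr (hW a)
    have h : (x * Y - (a : H)) * (x' * Y) = (a : H) * ((b : H) - x * Y) := by
      rw [sub_mul, ← hWV, hU, Quaternion.coe_mul_eq_smul, Quaternion.coe_mul_eq_smul]
      simp only [smul_add, smul_sub]
      abel
    have hV : x' * Y = (x * Y - (a : H))⁻¹ * ((a : H) * ((b : H) - x * Y)) := by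
      rw [← h, inv_mul_cancel_left₀ hWa]
    have hreal : ∀ r : ℝ, Commute (x * Y) (r : H) := fun r => (Quaternion.coe_commutes r _).symm
    have hW' : Commute (x * Y) (x' * Y) := by
      rw [hV]
      exact (((Commute.refl _).sub_right (hreal a)).inv_right₀).mul_right
        ((hreal a).mul_right ((hreal b).sub_right (Commute.refl _)))
    exact hW'
  have a0 : a ≠ 0 := by
    rintro rfl
    rw [zero_smul] at hWV
    exact mul_ne_zero (mul_ne_zero x0 Y0) (mul_ne_zero x'0 Y0) hWV.symm
  rw [← hcomm, ← hWV, smul_smul, ← haa] at hVW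
  have h := smul_left_injective ℝ (mul_ne_zero y'0 Y0) hVW
  exact mul_right_cancel₀ a0 h.symm

theorem cr_eq_div {p₁ p₂ p₃ p₄ X Y : H} {a b : ℝ} (h₁₄ : p₄ - p₁ ≠ 0)
    (h₂₃ : p₃ - p₂ ≠ 0) (hY : Y ≠ 0) (ha : X * (p₃ - p₄) = (a : H))
    (hb : Y * (p₃ - p₂) = (b : H)) (h : (p₂ - p₁) * Y = (p₄ - p₁) * X) :
    cr p₁ p₂ p₃ p₄ = ((a / b : ℝ) : H) := by
  have b0 : b ≠ 0 := by
    rintro rfl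
    exact mul_ne_zero hY h₂₃ (by simpa using hb)
  have hinv : (p₃ - p₂)⁻¹ = b⁻¹ • Y := by
    apply inv_eq_of_mul_eq_one_left
    rw [smul_mul_assoc, hb, ← Quaternion.coe_mul_eq_smul, ← Quaternion.coe_mul,
      inv_mul_cancel₀ b0, Quaternion.coe_one]
  calc cr p₁ p₂ p₃ p₄ = (p₂ - p₁) * (p₃ - p₂)⁻¹ * (p₃ - p₄) * (p₄ - p₁)⁻¹ := by
        rw [cr, ← neg_sub p₂ p₁, ← neg_sub p₃ p₂, inv_neg, neg_mul_neg]
    _ = b⁻¹ • ((p₄ - p₁) * (X * (p₃ - p₄)) * (p₄ - p₁)⁻¹) := by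
        rw [hinv, mul_smul_comm, h, smul_mul_assoc, smul_mul_assoc, mul_assoc (p₄ - p₁)]
    _ = ((a / b : ℝ) : H) := by
        rw [ha, Quaternion.mul_coe_eq_smul, smul_mul_assoc, mul_inv_cancel₀ h₁₄, smul_smul,
          ← Quaternion.coe_mul_eq_smul, mul_one, div_eq_inv_mul]

/-- If `𝔣, 𝔣*` are discrete nets satisfying the dual (Christoffel) relations and the
products `a_{m,n} = (∂₁𝔣*)(∂₁𝔣)` and `b_{m,n} = (∂₂𝔣*)(∂₂𝔣)` are real, then `a` depends
on `m` only, `b` depends on `n` only, and the cross ratios factorize as `q_{m,n} = a_m/b_n`. -/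
theorem stmt8 (f fs : ℤ → ℤ → H) (hf : IsNet f) (hfs : IsNet fs)
    (hdual : ∀ m n : ℤ,
      (fs (m+1) n - fs m n) * (f (m+1) (n+1) - f (m+1) n)
          = (fs m (n+1) - fs m n) * (f (m+1) (n+1) - f m (n+1)) ∧
      (f (m+1) n - f m n) * (fs (m+1) (n+1) - fs (m+1) n)
          = (f m (n+1) - f m n) * (fs (m+1) (n+1) - fs m (n+1)))
    (a b : ℤ → ℤ → ℝ)
    (ha : ∀ m n : ℤ, (fs (m+1) n - fs m n) * (f (m+1) n - f m n) = (a m n : H))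
    (hb : ∀ m n : ℤ, (fs m (n+1) - fs m n) * (f m (n+1) - f m n) = (b m n : H)) :
    ∃ A B : ℤ → ℝ, ∀ m n : ℤ, a m n = A m ∧ b m n = B n ∧
      cr (f m n) (f (m+1) n) (f (m+1) (n+1)) (f m (n+1)) = ((A m / B n : ℝ) : H) := by
  have key : ∀ m n, a m n = a m (n+1) ∧ b m n = b (m+1) n := fun m n =>
    quad_labels_eq (ha m n) (hb m n) (ha m (n+1)) (hb (m+1) n) (hdual m n).1 (hdual m n).2
      (by abel) (by abel) (hf m n).1 (hf m n).2.1 (hf m (n+1)).1 (hf (m+1) n).2.1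
      (hfs m n).2.1 (hf m n).2.2.1
  have hA : ∀ m n, a m n = a m 0 := fun m n => by
    induction n using Int.induction_on with
    | zero => rfl
    | succ k ih => rw [← (key m k).1, ih]
    | pred k ih => rw [(key m (-k - 1)).1, sub_add_cancel, ih]
  have hB : ∀ m n, b m n = b 0 n := fun m n => by
    induction m using Int.induction_on with
    | zero => rfl
    | succ k ih => rw [← (key k n).2, ih]
    | pred k ih => rw [(key (-k - 1) n).2, sub_add_cancel, ih]
  refine ⟨fun m => a m 0, fun n => b 0 n, fun m n => ⟨hA m n, hB m n, ?_⟩⟩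
  have h₁ := ha m (n+1)
  have h₂ := hb (m+1) n
  rw [hA] at h₁
  rw [hB] at h₂
  exact cr_eq_div (hf m n).2.1 (hf (m+1) n).2.1 (hfs (m+1) n).2.1
    h₁ h₂ (hdual m n).2
end
end

section
/- Let 𝔣 : ℤ² → ℍ with 𝔣_{m+1,n} ≠ 𝔣_{m,n}, let u_{m,n} ∈ ℍ, λ ∈ ℝ, and let U_{m,n} := f_{m,n}·u_{m,n}·φ_{m+1,n} ∈ M₂(ℍ) be the associated rank-one matrix. Then (I + λU_{m,n})f_{m,n} = f_{m,n}·(1 − λ·u_{m,n}(∂₁𝔣)_{m,n}) and (I + λU_{m,n})f_{m+1,n} = f_{m+1,n}, and the matrix I + λU_{m,n} is invertible in M₂(ℍ) if and only if λ·u_{m,n}(∂₁𝔣)_{m,n} ≠ 1. The analogous statement holds for V_{m,n} := f_{m,n}·v_{m,n}·φ_{m,n+1} when 𝔣_{m,n+1} ≠ 𝔣_{m,n}: I + λV_{m,n} is invertible if and only if λ·v_{m,n}(∂₂𝔣)_{m,n} ≠ 1. -/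
open Quaternion Matrix

noncomputable section

theorem smul_rankOne (c : ℝ) (x : Fin 2 → H) (q : H) (ψ : Fin 2 → H) :
    c • rankOne x q ψ = rankOne x ((c : H) * q) ψ := by
  ext1 i j
  simp only [rankOne, Matrix.smul_apply, Matrix.of_apply, ← Quaternion.coe_mul_eq_smul]
  rw [← mul_assoc, ← mul_assoc, ← mul_assoc, Quaternion.coe_commutes c (x i)]

theorem rankOne_mulVec (x : Fin 2 → H) (q : H) (ψ y : Fin 2 → H) :
    (rankOne x q ψ).mulVec y = fun k => x k * (q * (ψ ⬝ᵥ y)) := by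
  ext1 k
  simp only [rankOne, Matrix.mulVec, dotProduct, Matrix.of_apply, Finset.mul_sum, mul_assoc]

theorem rankOne_mul_rankOne (x : Fin 2 → H) (p q : H) (ψ : Fin 2 → H) :
    rankOne x p ψ * rankOne x q ψ = rankOne x (p * (ψ ⬝ᵥ x) * q) ψ := by
  ext1 i j
  simp only [rankOne, Matrix.mul_apply, dotProduct, Matrix.of_apply, Finset.mul_sum,
    Finset.sum_mul, mul_assoc]

theorem rankOne_add (x : Fin 2 → H) (p q : H) (ψ : Fin 2 → H) :
    rankOne x (p + q) ψ = rankOne x p ψ + rankOne x q ψ := by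
  ext1 i j
  simp only [rankOne, Matrix.add_apply, Matrix.of_apply, mul_add, add_mul]

theorem rankOne_zero (x ψ : Fin 2 → H) : rankOne x 0 ψ = 0 := by
  ext1 i j
  simp [rankOne]

theorem one_add_rankOne_mulVec_self (x : Fin 2 → H) (q : H) (ψ : Fin 2 → H) :
    (1 + rankOne x q ψ).mulVec x = fun k => x k * (1 + q * (ψ ⬝ᵥ x)) := by
  rw [Matrix.add_mulVec, Matrix.one_mulVec, rankOne_mulVec]
  ext1 k
  simp only [Pi.add_apply, mul_add, mul_one]

theorem one_add_rankOne_mul (x : Fin 2 → H) (p q : H) (ψ : Fin 2 → H)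
    (h : p + q + p * (ψ ⬝ᵥ x) * q = 0) :
    (1 + rankOne x p ψ) * (1 + rankOne x q ψ) = 1 := by
  have : (1 + rankOne x p ψ) * (1 + rankOne x q ψ)
      = 1 + rankOne x (p + q + p * (ψ ⬝ᵥ x) * q) ψ := by
    rw [rankOne_add, rankOne_add, ← rankOne_mul_rankOne]
    noncomm_ring
  rw [this, h, rankOne_zero, add_zero]

theorem isUnit_one_add_rankOne_iff {x : Fin 2 → H} (hx : x ≠ 0) (q : H) (ψ : Fin 2 → H) :
    IsUnit (1 + rankOne x q ψ) ↔ 1 + q * (ψ ⬝ᵥ x) ≠ 0 := by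
  constructor
  · rintro ⟨M, hM⟩ hc
    have hker := one_add_rankOne_mulVec_self x q ψ
    rw [hc, ← hM] at hker
    apply hx
    calc x = (M⁻¹.val * M.val).mulVec x := by rw [M.inv_mul, Matrix.one_mulVec]
      _ = M⁻¹.val.mulVec (M.val.mulVec x) := (Matrix.mulVec_mulVec _ _ _).symm
      _ = 0 := by
        rw [hker]
        simp only [mul_zero]
        exact Matrix.mulVec_zero _
  · intro hc
    set c := 1 + q * (ψ ⬝ᵥ x) with hc_def
    have hqd : q * (ψ ⬝ᵥ x) = c - 1 := by rw [hc_def]; abel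
    refine ⟨⟨1 + rankOne x q ψ, 1 + rankOne x (-(c⁻¹ * q)) ψ, one_add_rankOne_mul _ _ _ _ ?_,
      one_add_rankOne_mul _ _ _ _ ?_⟩, rfl⟩
    · rw [hqd, mul_neg, sub_mul, mul_inv_cancel_left₀ hc]
      noncomm_ring
    · rw [neg_mul, neg_mul, mul_assoc c⁻¹, hqd, mul_sub, inv_mul_cancel₀ hc]
      noncomm_ring

theorem vec_one_ne_zero (a : H) : (![1, a] : Fin 2 → H) ≠ 0 := fun h =>
  one_ne_zero (congrFun h 0)

theorem one_add_smul_rankOne_spec (a b q : H) (c : ℝ) :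
    ((1 + c • rankOne ![1, a] q ![-b, 1]).mulVec ![1, a]
        = fun k => (![1, a] : Fin 2 → H) k * (1 - (c : H) * (q * (b - a)))) ∧
    (1 + c • rankOne ![1, a] q ![-b, 1]).mulVec ![1, b] = ![1, b] ∧
    (IsUnit (1 + c • rankOne ![1, a] q ![-b, 1]) ↔ (c : H) * (q * (b - a)) ≠ 1) := by
  have hdot (y : H) : (![-b, 1] : Fin 2 → H) ⬝ᵥ ![1, y] = -(b - y) := by
    simp [dotProduct, Fin.sum_univ_two, sub_eq_neg_add, add_comm]
  have hc : 1 + (c : H) * q * ((![-b, 1] : Fin 2 → H) ⬝ᵥ ![1, a])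
      = 1 - (c : H) * (q * (b - a)) := by
    rw [hdot, mul_neg, mul_assoc, ← sub_eq_add_neg]
  rw [smul_rankOne]
  refine ⟨?_, ?_, ?_⟩
  · rw [one_add_rankOne_mulVec_self, hc]
  · rw [Matrix.add_mulVec, Matrix.one_mulVec, rankOne_mulVec, hdot, sub_self, neg_zero]
    simp only [mul_zero]
    exact add_zero _
  · rw [isUnit_one_add_rankOne_iff (vec_one_ne_zero a), hc, Ne, sub_eq_zero, eq_comm]

/-- `(I+λU_{m,n})` fixes `f_{m+1,n}` and rescales `f_{m,n}` by `1 − λu_{m,n}(∂₁𝔣)_{m,n}`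
from the right; it is invertible iff `λu_{m,n}(∂₁𝔣)_{m,n} ≠ 1`; and analogously for `V`. -/
theorem stmt9 (f u v : ℤ → ℤ → H) (lam : ℝ) (m n : ℤ)
    (h1 : f (m+1) n ≠ f m n) (h2 : f m (n+1) ≠ f m n) :
    ((1 + lam • Umat f u m n).mulVec (fvec f m n)
        = fun k => fvec f m n k * (1 - (lam : H) * (u m n * (f (m+1) n - f m n)))) ∧
    (1 + lam • Umat f u m n).mulVec (fvec f (m+1) n) = fvec f (m+1) n ∧
    (IsUnit (1 + lam • Umat f u m n) ↔ (lam : H) * (u m n * (f (m+1) n - f m n)) ≠ 1) ∧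
    ((1 + lam • Vmat f v m n).mulVec (fvec f m n)
        = fun k => fvec f m n k * (1 - (lam : H) * (v m n * (f m (n+1) - f m n)))) ∧
    (1 + lam • Vmat f v m n).mulVec (fvec f m (n+1)) = fvec f m (n+1) ∧
    (IsUnit (1 + lam • Vmat f v m n) ↔ (lam : H) * (v m n * (f m (n+1) - f m n)) ≠ 1) := by
  obtain ⟨hU, hU', hU_unit⟩ := one_add_smul_rankOne_spec (f m n) (f (m+1) n) (u m n) lam
  obtain ⟨hV, hV', hV_unit⟩ := one_add_smul_rankOne_spec (f m n) (f m (n+1)) (v m n) lam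
  exact ⟨hU, hU', hU_unit, hV, hV', hV_unit⟩
end
end

section
/- Fix (m,n) ∈ ℤ². Let 𝔣, 𝔣̂ : ℤ² → ℍ and λ, a ∈ ℝ with λa ≠ 0, and assume (∂₁𝔣)_{m,n} ≠ 0, 𝔣̂_{m,n} ≠ 𝔣_{m,n} and 𝔣̂_{m+1,n} ≠ 𝔣_{m+1,n}. Then the Riccati equation (∂₁𝔣̂)_{m,n} = λ·(𝔣̂ − 𝔣)_{m,n}·a·((∂₁𝔣)_{m,n})⁻¹·(𝔣̂ − 𝔣)_{m+1,n} holds if and only if the cross ratio of the quadrilateral built from the corresponding edges of 𝔣 and 𝔣̂ equals λa: cr(𝔣_{m,n}, 𝔣_{m+1,n}, 𝔣̂_{m+1,n}, 𝔣̂_{m,n}) = λa. The analogous equivalence holds in the second lattice direction with b in place of a. -/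
open Quaternion

noncomputable section

section DivisionRing

variable {K : Type*} [DivisionRing K] {c : K}

/-- Two elements `p`, `q` with `1 + q - p = c * (p * q)`, where `c` is central, commute. -/
theorem commute_of_one_add_sub_eq (hc : ∀ x : K, Commute c x) {p q : K}
    (h : 1 + q - p = c * (p * q)) : Commute p q := by
  have hpq : p * (1 + c * q) = 1 + q := by
    rw [mul_add, mul_one, ← mul_assoc, ← (hc p).eq, mul_assoc, ← h]
    abel
  have hq : Commute q (1 + c * q) :=
    (Commute.one_right q).add_right ((hc q).symm.mul_right (Commute.refl q))
  by_cases h0 : 1 + c * q = 0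
  · have hq1 : q = -1 := by
      rw [h0, mul_zero] at hpq
      exact (neg_eq_of_add_eq_zero_right hpq.symm).symm
    rw [hq1]
    exact (Commute.one_right p).neg_right
  · rw [(eq_mul_inv_iff_mul_eq₀ h0).2 hpq]
    exact (((Commute.one_right q).add_right (Commute.refl q)).mul_right hq.inv_right₀).symm

theorem one_add_sub_eq_mul_comm_iff (hc : ∀ x : K, Commute c x) (p q : K) :
    1 + q - p = c * (p * q) ↔ 1 + q - p = c * (q * p) := by
  constructor <;> intro h
  · rw [← (commute_of_one_add_sub_eq hc h).eq, h]
  · have h' : 1 + -p - -q = c * (-q * -p) := by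
      rw [neg_mul_neg, ← h]
      abel
    have hqp : Commute q p := by simpa using commute_of_one_add_sub_eq hc h'
    rw [← hqp.eq, h]

theorem riccati_iff_crossRatio (hc : ∀ x : K, Commute c x) {d u v : K}
    (hd : d ≠ 0) (hu : u ≠ 0) (hv : v ≠ 0) :
    d + v - u = c * (u * d⁻¹ * v) ↔ d * v⁻¹ * (d + v - u) * u⁻¹ = c := by
  have key (x y : K) : d + v - u = c * (x * d⁻¹ * y) ↔
      1 + d⁻¹ * v - d⁻¹ * u = c * (d⁻¹ * x * (d⁻¹ * y)) := by
    rw [← mul_right_inj' (inv_ne_zero hd), mul_sub, mul_add, inv_mul_cancel₀ hd,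
      ← mul_assoc d⁻¹ c, ← (hc d⁻¹).eq]
    simp only [mul_assoc]
  rw [key u v, one_add_sub_eq_mul_comm_iff hc, ← key v u, mul_inv_eq_iff_eq_mul₀ hu]
  have hdv : d * v⁻¹ ≠ 0 := mul_ne_zero hd (inv_ne_zero hv)
  rw [← mul_right_inj' hdv, ← mul_assoc (d * v⁻¹) c, ← (hc (d * v⁻¹)).eq]
  have hcancel : d * v⁻¹ * (v * d⁻¹ * u) = u := by
    simp [mul_assoc, hd, hv]
  rw [mul_assoc c, hcancel]

end DivisionRing

theorem riccati_iff_cr (lam a : ℝ) {x y xh yh : H}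
    (hd : y - x ≠ 0) (hx : xh ≠ x) (hy : yh ≠ y) :
    yh - xh = (lam : H) * ((xh - x) * ((a : H) * (y - x)⁻¹) * (yh - y)) ↔
      cr x y yh xh = ((lam * a : ℝ) : H) := by
  have hc (z : H) : Commute ((lam * a : ℝ) : H) z := Quaternion.coe_commutes _ z
  have h := riccati_iff_crossRatio hc hd (sub_ne_zero.2 hx) (sub_ne_zero.2 hy)
  have he : y - x + (yh - y) - (xh - x) = yh - xh := by abel
  have hr : (lam : H) * ((xh - x) * ((a : H) * (y - x)⁻¹) * (yh - y)) =
      ((lam * a : ℝ) : H) * ((xh - x) * (y - x)⁻¹ * (yh - y)) := by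
    rw [← mul_assoc (xh - x), ← Quaternion.coe_commutes a (xh - x), Quaternion.coe_mul]
    simp only [mul_assoc]
  have hcr : cr x y yh xh = (y - x) * (yh - y)⁻¹ * (yh - xh) * (xh - x)⁻¹ := by
    rw [cr, ← neg_sub y x, ← neg_sub yh y, inv_neg, neg_mul_neg]
  rw [he] at h
  rw [hr, hcr, h]

/-- The Riccati equation for an edge is equivalent to the cross ratio condition
`cr(𝔣_{m,n}, 𝔣_{m+1,n}, 𝔣̂_{m+1,n}, 𝔣̂_{m,n}) = λa` (and analogously in the second
lattice direction with `b`). -/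
theorem stmt14 (f fh : ℤ → ℤ → H) (lam a b : ℝ) (m n : ℤ)
    (hla : lam * a ≠ 0) (hlb : lam * b ≠ 0)
    (hd1 : f (m+1) n - f m n ≠ 0) (hd2 : f m (n+1) - f m n ≠ 0)
    (h0 : fh m n ≠ f m n) (h1 : fh (m+1) n ≠ f (m+1) n) (h2 : fh m (n+1) ≠ f m (n+1)) :
    ((fh (m+1) n - fh m n
        = (lam : H) * ((fh m n - f m n) * ((a : H) * (f (m+1) n - f m n)⁻¹) *
            (fh (m+1) n - f (m+1) n))) ↔
      cr (f m n) (f (m+1) n) (fh (m+1) n) (fh m n) = ((lam * a : ℝ) : H)) ∧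
    ((fh m (n+1) - fh m n
        = (lam : H) * ((fh m n - f m n) * ((b : H) * (f m (n+1) - f m n)⁻¹) *
            (fh m (n+1) - f m (n+1)))) ↔
      cr (f m n) (f m (n+1)) (fh m (n+1)) (fh m n) = ((lam * b : ℝ) : H)) := by
  exact ⟨riccati_iff_cr lam a hd1 h0 h1, riccati_iff_cr lam b hd2 h0 h2⟩
end
end

section
/- (Permutability of the Christoffel and Darboux transformations, D_λC = CD_λ.) Let 𝔣 : ℤ² → ℍ be a discrete net with Christoffel transform 𝔣* satisfying (∂₁𝔣*)_{m,n} = a_m·((∂₁𝔣)_{m,n})⁻¹ and (∂₂𝔣*)_{m,n} = b_n·((∂₂𝔣)_{m,n})⁻¹ for nowhere zero a, b : ℤ → ℝ. Let λ ∈ ℝ \ {0} and let 𝔣̂ : ℤ² → ℍ satisfy the Riccati (Darboux) system with respect to (𝔣, 𝔣*) with parameter λ, with 𝔣̂_{m,n} ≠ 𝔣_{m,n} for all (m,n). Define 𝔣̃ := 𝔣* + λ⁻¹(𝔣̂ − 𝔣)⁻¹. Then: (i) 𝔣̃ satisfies the Riccati (Darboux) system with respect to (𝔣*, 𝔣) with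 parameter λ, i.e. (∂₁𝔣̃)_{m,n} = λ(𝔣̃−𝔣*)_{m,n}(∂₁𝔣)_{m,n}(𝔣̃−𝔣*)_{m+1,n} and (∂₂𝔣̃)_{m,n} = λ(𝔣̃−𝔣*)_{m,n}(∂₂𝔣)_{m,n}(𝔣̃−𝔣*)_{m,n+1}; and (ii) 𝔣̃ is a Christoffel transform of 𝔣̂ with the same factorization: (∂₁𝔣̃)_{m,n}(∂₁𝔣̂)_{m,n} = (∂₁𝔣)_{m,n}(∂₁𝔣*)_{m,n} = a_m and (∂₂𝔣̃)_{m,n}(∂₂𝔣̂)_{m,n} = (∂₂𝔣)_{m,n}(∂₂𝔣*)_{m,n} = b_n. -/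
open Quaternion

noncomputable section

/-- `𝔥` satisfies the Riccati (Darboux) system with respect to `(𝔤, 𝔤*)` with parameter `λ`:
`(∂₁𝔥)_{m,n} = λ(𝔥−𝔤)_{m,n}(∂₁𝔤*)_{m,n}(𝔥−𝔤)_{m+1,n}` and
`(∂₂𝔥)_{m,n} = λ(𝔥−𝔤)_{m,n}(∂₂𝔤*)_{m,n}(𝔥−𝔤)_{m,n+1}`. -/
def Riccati (g gs h : ℤ → ℤ → H) (lam : ℝ) : Prop :=
  ∀ m n : ℤ,
    h (m+1) n - h m n
      = (lam : H) * ((h m n - g m n) * (gs (m+1) n - gs m n) * (h (m+1) n - g (m+1) n)) ∧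
    h m (n+1) - h m n
      = (lam : H) * ((h m n - g m n) * (gs m (n+1) - gs m n) * (h m (n+1) - g m (n+1)))

/-- In a division ring, if `1 = x - y + c x y` with `c` central, then `x` and `y` commute. -/
theorem commute_of_one_eq_sub_add {K : Type*} [DivisionRing K] {c x y : K}
    (hc : ∀ z : K, Commute c z) (h : 1 = x - y + c * (x * y)) : Commute x y := by
  by_cases h0 : c * x - 1 = 0
  · have hx : c * x = 1 := sub_eq_zero.mp h0
    have hc0 : c ≠ 0 := left_ne_zero_of_mul_eq_one hx
    rw [eq_inv_of_mul_eq_one_right hx]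
    exact (hc y).inv_left₀
  · have hy : (c * x - 1) * y = 1 - x := by
      rw [sub_mul, one_mul, mul_assoc, sub_eq_iff_eq_add]
      calc c * (x * y) = x - y + c * (x * y) - x + y := by abel
        _ = 1 - x + y := by rw [← h]
    have hcx : (c * x - 1) * x = x * (c * x - 1) := by
      have := (hc x).eq
      rw [sub_mul, mul_sub, ← mul_assoc x, ← this, one_mul, mul_one]
    refine mul_left_cancel₀ h0 ?_
    rw [← mul_assoc, hcx, mul_assoc, hy, ← mul_assoc, hy]
    noncomm_ring

/-- The Christoffel and Darboux relations along a single edge: `d` and `s` are dual edges,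
`u` and `v` the differences between a net and its Darboux transform at the two endpoints. -/
theorem darboux_christoffel_edge {K : Type*} [DivisionRing K] {α l d s u v : K}
    (hα : ∀ z : K, Commute α z) (hl : ∀ z : K, Commute l z) (hl0 : l ≠ 0)
    (hd : d ≠ 0) (hu : u ≠ 0) (hv : v ≠ 0) (hs : s = α * d⁻¹)
    (hR : v - u + d = l * (u * s * v)) :
    s + l⁻¹ * v⁻¹ - l⁻¹ * u⁻¹ = l * (l⁻¹ * u⁻¹ * d * (l⁻¹ * v⁻¹)) ∧
      (s + l⁻¹ * v⁻¹ - l⁻¹ * u⁻¹) * (v - u + d) = d * s ∧ d * s = α := by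
  have hli : ∀ z : K, Commute l⁻¹ z := fun z => (hl z).inv_left₀
  have hds : d * s = α := by
    rw [hs, ← mul_assoc, ← (hα d).eq, mul_inv_cancel_right₀ hd]
  have hedge : s + l⁻¹ * v⁻¹ - l⁻¹ * u⁻¹ = l⁻¹ * (u⁻¹ * d * v⁻¹) := by
    have hd' : d = u - v + l * (u * s * v) := by rw [← hR]; abel
    have h1 : u⁻¹ * d * v⁻¹ = v⁻¹ - u⁻¹ + l * s := by
      calc u⁻¹ * d * v⁻¹ = u⁻¹ * (u - v + u * (l * s) * v) * v⁻¹ := by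
            rw [← mul_assoc u l s, ← (hl u).eq, mul_assoc l u s, mul_assoc l, ← hd']
        _ = (u⁻¹ * u) * v⁻¹ - u⁻¹ * (v * v⁻¹) + (u⁻¹ * u) * (l * s) * (v * v⁻¹) := by
            noncomm_ring
        _ = v⁻¹ - u⁻¹ + l * s := by
            rw [inv_mul_cancel₀ hu, mul_inv_cancel₀ hv]; simp
    rw [h1, mul_add, mul_sub, inv_mul_cancel_left₀ hl0]
    abel
  have hcomm : u * d⁻¹ * v = v * d⁻¹ * u := by
    have hc : ∀ z : K, Commute (l * α) z := fun z => (hl z).mul_left (hα z)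
    have h : (1 : K) = d⁻¹ * u - d⁻¹ * v + l * α * (d⁻¹ * u * (d⁻¹ * v)) := by
      calc (1 : K) = d⁻¹ * (u - v + (v - u + d)) := by
            rw [show u - v + (v - u + d) = d by abel, inv_mul_cancel₀ hd]
        _ = d⁻¹ * (u - v + l * α * (u * d⁻¹ * v)) := by
            rw [hR, hs, ← mul_assoc u α, ← (hα u).eq]; simp only [mul_assoc]
        _ = d⁻¹ * u - d⁻¹ * v + l * α * (d⁻¹ * u * (d⁻¹ * v)) := by
            rw [mul_add, mul_sub, ← mul_assoc d⁻¹ (l * α), ← (hc d⁻¹).eq]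
            simp only [mul_assoc]
    have h2 := (commute_of_one_eq_sub_add hc h).eq
    refine mul_left_cancel₀ (inv_ne_zero hd) ?_
    simpa only [mul_assoc] using h2
  refine ⟨?_, ?_, hds⟩
  · rw [hedge, mul_assoc l⁻¹ u⁻¹ d, mul_assoc l⁻¹, mul_inv_cancel_left₀ hl0,
      ← mul_assoc (u⁻¹ * d), ← (hli (u⁻¹ * d)).eq]
    simp only [mul_assoc]
  · calc (s + l⁻¹ * v⁻¹ - l⁻¹ * u⁻¹) * (v - u + d)
        = l⁻¹ * (u⁻¹ * d * v⁻¹) * (l * (α * (u * d⁻¹ * v))) := by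
          rw [hedge, hR, hs, ← mul_assoc u α, ← (hα u).eq]; simp only [mul_assoc]
      _ = α * (u⁻¹ * d * v⁻¹ * (v * d⁻¹ * u)) := by
          rw [hcomm, (hli _).eq, mul_assoc, inv_mul_cancel_left₀ hl0, ← mul_assoc,
            ← (hα _).eq, mul_assoc]
      _ = α := by
          simp only [mul_assoc, inv_mul_cancel_left₀ hv, mul_inv_cancel_left₀ hd,
            inv_mul_cancel₀ hu, mul_one]
      _ = d * s := hds.symm

/-- The permutability relations between two neighbouring vertices of the nets. -/
theorem darboux_christoffel_vertices {α l : ℝ} {p q ps qs ph qh pt qt : H} (hl0 : l ≠ 0)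
    (hd : q - p ≠ 0) (hp : ph ≠ p) (hq : qh ≠ q) (hs : qs - ps = (α : H) * (q - p)⁻¹)
    (hR : qh - ph = (l : H) * ((ph - p) * (qs - ps) * (qh - q)))
    (hpt : pt = ps + ((l⁻¹ : ℝ) : H) * (ph - p)⁻¹)
    (hqt : qt = qs + ((l⁻¹ : ℝ) : H) * (qh - q)⁻¹) :
    qt - pt = (l : H) * ((pt - ps) * (q - p) * (qt - qs)) ∧
      (qt - pt) * (qh - ph) = (q - p) * (qs - ps) ∧ (q - p) * (qs - ps) = (α : H) := by
  have hl0' : (l : H) ≠ 0 := fun h => hl0 (Quaternion.coe_injective h)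
  have hinv : ((l⁻¹ : ℝ) : H) = (l : H)⁻¹ := Quaternion.coe_inv l
  have hqp : qh - q - (ph - p) + (q - p) = qh - ph := by abel
  have key := darboux_christoffel_edge (Quaternion.coe_commutes α) (Quaternion.coe_commutes l)
    hl0' hd (sub_ne_zero.mpr hp) (sub_ne_zero.mpr hq) hs (hqp.trans hR)
  have ht : qt - pt = qs - ps + (l : H)⁻¹ * (qh - q)⁻¹ - (l : H)⁻¹ * (ph - p)⁻¹ := by
    rw [hpt, hqt, hinv]; abel
  have hpt' : pt - ps = (l : H)⁻¹ * (ph - p)⁻¹ := by rw [hpt, hinv, add_sub_cancel_left]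
  have hqt' : qt - qs = (l : H)⁻¹ * (qh - q)⁻¹ := by rw [hqt, hinv, add_sub_cancel_left]
  rwa [hqp, ← ht, ← hpt', ← hqt'] at key

/-- (Permutability `D_λC = CD_λ`.)  For a Christoffel pair `(𝔣, 𝔣*)` and a Darboux
transform `𝔣̂ = D_λ𝔣`, the net `𝔣̃ = 𝔣* + λ⁻¹(𝔣̂−𝔣)⁻¹` is a Darboux transform of `𝔣*`
(with respect to `(𝔣*, 𝔣)`) and a Christoffel transform of `𝔣̂` with the same
factorization `a_m`, `b_n`. -/
theorem stmt18 (f fs fh ft : ℤ → ℤ → H) (a b : ℤ → ℝ)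
    (hf : IsNet f)
    (ha0 : ∀ m : ℤ, a m ≠ 0) (hb0 : ∀ n : ℤ, b n ≠ 0)
    (hC1 : ∀ m n : ℤ, fs (m+1) n - fs m n = (a m : H) * (f (m+1) n - f m n)⁻¹)
    (hC2 : ∀ m n : ℤ, fs m (n+1) - fs m n = (b n : H) * (f m (n+1) - f m n)⁻¹)
    (lam : ℝ) (hlam : lam ≠ 0)
    (hR : Riccati f fs fh lam) (hne : ∀ m n : ℤ, fh m n ≠ f m n)
    (hft : ∀ m n : ℤ, ft m n = fs m n + ((lam⁻¹ : ℝ) : H) * (fh m n - f m n)⁻¹) :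
    Riccati fs f ft lam ∧
    (∀ m n : ℤ,
      (ft (m+1) n - ft m n) * (fh (m+1) n - fh m n)
          = (f (m+1) n - f m n) * (fs (m+1) n - fs m n) ∧
      (f (m+1) n - f m n) * (fs (m+1) n - fs m n) = (a m : H) ∧
      (ft m (n+1) - ft m n) * (fh m (n+1) - fh m n)
          = (f m (n+1) - f m n) * (fs m (n+1) - fs m n) ∧
      (f m (n+1) - f m n) * (fs m (n+1) - fs m n) = (b n : H)) := by
  have h₁ := fun m n => darboux_christoffel_vertices hlam (hf m n).1 (hne m n) (hne (m+1) n)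
    (hC1 m n) (hR m n).1 (hft m n) (hft (m+1) n)
  have h₂ := fun m n => darboux_christoffel_vertices hlam (hf m n).2.1 (hne m n) (hne m (n+1))
    (hC2 m n) (hR m n).2 (hft m n) (hft m (n+1))
  exact ⟨fun m n => ⟨(h₁ m n).1, (h₂ m n).1⟩,
    fun m n => ⟨(h₁ m n).2.1, (h₁ m n).2.2, (h₂ m n).2.1, (h₂ m n).2.2⟩⟩
end
end

section
/- Let 𝔣, 𝔣* : ℤ² → ℍ and λ ∈ ℝ, λ ≠ 0, and set K := [[0, λ],[1, 0]] ∈ M₂(ℍ). If F : ℤ² → M₂(ℍ) satisfies the difference system F_{m+1,n} = F_{m,n}·[[1, λ(∂₁𝔣*)_{m,n}],[(∂₁𝔣)_{m,n}, 1]] and F_{m,n+1} = F_{m,n}·[[1, λ(∂₂𝔣*)_{m,n}],[(∂₂𝔣)_{m,n}, 1]], then G := F·K (pointwise product) satisfies the same system with the roles of 𝔣 and 𝔣* interchanged: G_{m+1,n} = G_{m,n}·[[1, λ(∂₁𝔣)_{m,n}],[(∂₁𝔣*)_{m,n}, 1]] and G_{m,n+1} = G_{m,n}·[[1, λ(∂₂𝔣)_{m,n}],[(∂₂𝔣*)_{m,n},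 1]]. Equivalently, K⁻¹·[[1, λu],[w, 1]]·K = [[1, λw],[u, 1]] for all quaternions u, w. (This is the algebraic content of the fact that the spectral transforms of a Christoffel pair of isothermic nets form a Darboux pair: T^λC = D_{−λ}T^λ.) -/
open Quaternion Matrix

noncomputable section

/-- The constant matrix `K = [[0,λ],[1,0]]`. -/
def Kmat (lam : ℝ) : M2 := !![0, (lam : H); 1, 0]

/-- The inverse `K⁻¹ = [[0,1],[λ⁻¹,0]]` of `K`. -/
def Kinv (lam : ℝ) : M2 := !![0, 1; ((lam : H))⁻¹, 0]

/-- Conjugation by `K` exchanges the off-diagonal data: `[[1,λu],[w,1]]·K = K·[[1,λw],[u,1]]`. -/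
theorem mul_Kmat (lam : ℝ) (u w : H) :
    (!![1, (lam : H) * u; w, 1] : M2) * Kmat lam = Kmat lam * !![1, (lam : H) * w; u, 1] := by
  simp [Kmat, (Quaternion.coe_commutes lam w).symm]

theorem Kmat_mul_Kinv {lam : ℝ} (hlam : lam ≠ 0) : Kmat lam * Kinv lam = 1 := by
  have h : (lam : H) ≠ 0 := by simpa using Quaternion.coe_injective.ne hlam
  simp [Kmat, Kinv, Matrix.one_fin_two, mul_inv_cancel₀ h]

theorem Kinv_mul_Kmat {lam : ℝ} (hlam : lam ≠ 0) : Kinv lam * Kmat lam = 1 := by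
  have h : (lam : H) ≠ 0 := by simpa using Quaternion.coe_injective.ne hlam
  simp [Kmat, Kinv, Matrix.one_fin_two, inv_mul_cancel₀ h]

/-- If `F` solves the curved-flat system for the Christoffel pair `(𝔣, 𝔣*)`, then `G = F·K`
solves the same system with the roles of `𝔣` and `𝔣*` interchanged; equivalently
`K⁻¹·[[1,λu],[w,1]]·K = [[1,λw],[u,1]]` for all quaternions `u, w`. -/
theorem stmt19 (f fs : ℤ → ℤ → H) (lam : ℝ) (hlam : lam ≠ 0)
    (F : ℤ → ℤ → M2)
    (hF1 : ∀ m n : ℤ, F (m+1) n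
        = F m n * !![1, (lam : H) * (fs (m+1) n - fs m n); f (m+1) n - f m n, 1])
    (hF2 : ∀ m n : ℤ, F m (n+1)
        = F m n * !![1, (lam : H) * (fs m (n+1) - fs m n); f m (n+1) - f m n, 1]) :
    (∀ m n : ℤ, F (m+1) n * Kmat lam
        = (F m n * Kmat lam) * !![1, (lam : H) * (f (m+1) n - f m n); fs (m+1) n - fs m n, 1]) ∧
    (∀ m n : ℤ, F m (n+1) * Kmat lam
        = (F m n * Kmat lam) * !![1, (lam : H) * (f m (n+1) - f m n); fs m (n+1) - fs m n, 1]) ∧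
    Kmat lam * Kinv lam = 1 ∧ Kinv lam * Kmat lam = 1 ∧
    (∀ u w : H, Kinv lam * !![1, (lam : H) * u; w, 1] * Kmat lam
        = !![1, (lam : H) * w; u, 1]) := by
  refine ⟨fun m n => ?_, fun m n => ?_, Kmat_mul_Kinv hlam, Kinv_mul_Kmat hlam, fun u w => ?_⟩
  · rw [hF1, mul_assoc, mul_Kmat, mul_assoc]
  · rw [hF2, mul_assoc, mul_Kmat, mul_assoc]
  · rw [mul_assoc, mul_Kmat, ← mul_assoc, Kinv_mul_Kmat hlam, one_mul]
end
end
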